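/- Let F be an algebraically closed field, R an associative F-algebra, V a finite-dimensional F-subspace of R, and n a positive integer such that every nonzero element of V has nonzero n-th power. Then for every positive integer i ≤ n, the subspace V^i (the F-span of all i-fold products of elements of V) satisfies dim V^i ≥ dim V. -/

import Mathlib

open Pointwise

/-- `pw x n` is the `n`-th power of `x` in any magma, for `n ≥ 1`
(with the junk value `pw x 0 = x`). -/
def pw {R : Type*} [Mul R] (x : R) : ℕ → R
  | 0 => x
  | 1 => x
  | n + 2 => x * pw x (n + 1)

/-- Product of submodules of a (possibly nonunital) algebra: the span of the
set of products. -/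
noncomputable instance submul {F R : Type*} [Semiring F] [NonUnitalNonAssocSemiring R]
    [Module F R] : Mul (Submodule F R) :=
  ⟨fun V W => Submodule.span F (Set.image2 (· * ·) (V : Set R) (W : Set R))⟩

/-- Polynomials in finitely many variables over an algebraically closed field whose only common
zero is the origin must be at least as many as the variables. -/
theorem MvPolynomial.card_le_of_forall_eval_eq_zero_iff {F σ ι : Type*} [Field F] [IsAlgClosed F]
    [Finite σ] [Fintype ι] (f : ι → MvPolynomial σ F)
    (hf : ∀ x : σ → F, (∀ j, eval x (f j) = 0) ↔ x = 0) :
    Nat.card σ ≤ Fintype.card ι := by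
  have key : ringKrullDim (MvPolynomial σ F) ≤ (Fintype.card ι : ℕ∞) := by
    refine (ringKrullDim_le_iff_isMaximal_height_le _).mpr fun M hM ↦ ?_
    obtain ⟨a, rfl⟩ := isMaximal_iff_eq_vanishingIdeal_singleton.mp hM
    let g : ι → MvPolynomial σ F := fun j ↦ aeval (fun i ↦ X i - C (a i)) (f j)
    have hg (x : σ → F) (j : ι) : eval x (g j) = eval (x - a) (f j) := by
      have : (aeval x).comp (aeval fun i ↦ X i - C (a i)) =
          (aeval (x - a) : MvPolynomial σ F →ₐ[F] F) := by
        ext i; simp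
      simpa [g, aeval_eq_eval] using DFunLike.congr_fun this (f j)
    have hzero : zeroLocus F (Ideal.span (Set.range g)) = {a} := by
      ext x
      simp [zeroLocus_span, aeval_eq_eval, hg, hf, sub_eq_zero]
    have hrad : (Ideal.span (Set.range g)).radical = vanishingIdeal F {a} := by
      rw [← vanishingIdeal_zeroLocus_eq_radical (K := F), hzero]
    have hmin : vanishingIdeal F {a} ∈ (Ideal.span (Set.range g)).minimalPrimes := by
      rw [← Ideal.radical_minimalPrimes, hrad, Ideal.minimalPrimes_eq_subsingleton_self]
      exact Set.mem_singleton _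
    refine WithBot.coe_le_coe.mpr
      ((Ideal.height_le_card_of_mem_minimalPrimes_span (Set.finite_range g) hmin).trans ?_)
    rw [← Set.image_univ, ← Nat.card_eq_fintype_card, ← Set.ncard_univ]
    exact_mod_cast Set.ncard_image_le
  rw [ringKrullDim_of_isNoetherianRing, ringKrullDim_eq_zero_of_field, zero_add] at key
  exact_mod_cast key

theorem pw_succ {R : Type*} [Mul R] (x : R) {n : ℕ} (hn : 1 ≤ n) :
    pw x (n + 1) = x * pw x n := by
  obtain ⟨n, rfl⟩ := Nat.exists_eq_add_of_le' hn
  rfl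

theorem pw_zero_left {R : Type*} [NonUnitalNonAssocSemiring R] {n : ℕ} (hn : 1 ≤ n) :
    pw (0 : R) n = 0 := by
  induction n, hn using Nat.le_induction with
  | base => rfl
  | succ n hn _ => rw [pw_succ _ hn, zero_mul]

theorem pw_eq_zero_of_le {R : Type*} [NonUnitalNonAssocSemiring R] {x : R} {m n : ℕ}
    (hm : 1 ≤ m) (hmn : m ≤ n) (hx : pw x m = 0) : pw x n = 0 := by
  induction n, hmn using Nat.le_induction with
  | base => exact hx
  | succ n hmn ih => rw [pw_succ _ (hm.trans hmn), ih, mul_zero]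

section Submodule

variable {F R : Type*} [Semiring F] [NonUnitalNonAssocSemiring R] [Module F R]

theorem pw_mem_pw {V : Submodule F R} {x : R} (hx : x ∈ V) {n : ℕ} (hn : 1 ≤ n) :
    pw x n ∈ pw V n := by
  induction n, hn using Nat.le_induction with
  | base => exact hx
  | succ n hn ih =>
    rw [pw_succ _ hn, pw_succ _ hn]
    exact Submodule.subset_span (Set.mem_image2_of_mem hx ih)

end Submodule

section Algebra

variable {F R : Type*} [Field F] [NonUnitalNonAssocRing R] [Module F R]
  [SMulCommClass F R R] [IsScalarTower F R R]

theorem fg_submul {V W : Submodule F R} (hV : V.FG) (hW : W.FG) : (V * W).FG := by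
  have : V * W = Submodule.map₂ (LinearMap.mul F R) V W :=
    (Submodule.map₂_eq_span_image2 (LinearMap.mul F R) V W).symm
  rw [this]
  exact hV.map₂ _ hW

theorem fg_pw {V : Submodule F R} (hV : V.FG) {n : ℕ} (hn : 1 ≤ n) : (pw V n).FG := by
  induction n, hn using Nat.le_induction with
  | base => exact hV
  | succ n hn ih =>
    rw [pw_succ _ hn]
    exact fg_submul hV ih

/-- A linear functional of the `n`-th power of a linear combination is a polynomial in the
coefficients. -/
theorem exists_eval_eq_pw_sum {ι : Type*} [Fintype ι] (b : ι → R) {n : ℕ} (hn : 1 ≤ n)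
    (φ : R →ₗ[F] F) :
    ∃ f : MvPolynomial ι F, ∀ x : ι → F, MvPolynomial.eval x f = φ (pw (∑ l, x l • b l) n) := by
  induction n, hn using Nat.le_induction generalizing φ with
  | base =>
    refine ⟨∑ l, MvPolynomial.X l * MvPolynomial.C (φ (b l)), fun x ↦ ?_⟩
    simp [pw]
  | succ n hn ih =>
    choose g hg using fun l ↦ ih (φ ∘ₗ LinearMap.mulLeft F (b l))
    refine ⟨∑ l, MvPolynomial.X l * g l, fun x ↦ ?_⟩
    rw [pw_succ _ hn, Finset.sum_mul]
    simp [hg, smul_mul_assoc]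

end Algebra

theorem stmt_3 {F R : Type*} [Field F] [IsAlgClosed F]
    [NonUnitalRing R] [Module F R] [SMulCommClass F R R] [IsScalarTower F R R]
    (V : Submodule F R) (hV : FiniteDimensional F V)
    (n : ℕ) (hn : 1 ≤ n) (hpow : ∀ v ∈ V, v ≠ 0 → pw v n ≠ 0) :
    ∀ i, 1 ≤ i → i ≤ n → Module.finrank F ↥V ≤ Module.finrank F ↥(pw V i) := by
  intro i hi hin
  have : FiniteDimensional F ↥(pw V i) :=
    Module.Finite.iff_fg.mpr (fg_pw (Module.Finite.iff_fg.mp hV) hi)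
  let b := Module.finBasis F V
  let c := Module.finBasis F ↥(pw V i)
  choose ψ hψ using fun j ↦ LinearMap.exists_extend (c.coord j)
  choose f hf using fun j ↦ exists_eval_eq_pw_sum (fun l ↦ (b l : R)) hi (ψ j)
  have hsum (x) : ∑ l, x l • (b l : R) = (b.equivFun.symm x : V) := by
    simp [Module.Basis.equivFun_symm_apply]
  have hcoord (x j) : MvPolynomial.eval x (f j) =
      c.coord j ⟨_, pw_mem_pw (b.equivFun.symm x).2 hi⟩ := by
    rw [hf, hsum, ← hψ]
    rfl
  have hzero (x) : (∀ j, MvPolynomial.eval x (f j) = 0) ↔ x = 0 := by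
    simp_rw [hcoord]
    rw [c.forall_coord_eq_zero_iff, Submodule.mk_eq_zero]
    constructor
    · intro h
      by_contra hx
      exact hpow _ (b.equivFun.symm x).2
        (by rwa [Ne, Submodule.coe_eq_zero, LinearEquiv.map_eq_zero_iff]) (pw_eq_zero_of_le hi hin h)
    · rintro rfl
      simpa using pw_zero_left hi
  simpa using MvPolynomial.card_le_of_forall_eval_eq_zero_iff f hzero
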